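/- arXiv:1508.02701 — 4 statements merged into one kernel-verified Lean document; each statement's English description precedes it below -/
import Mathlib

section
/- Let d ≥ 1. For each R ≥ 1 there exists a constant C > 0 such that for every x, y ∈ ℝ^d with max{|x|, |y|} ≥ R^{1/2} and |x − y| ≤ R^{1/2}, one has | (x − y) − ( ψ'(|x|²/R) x − ψ'(|y|²/R) y ) | ≤ C ( F_R(|x|) + (|x|²/R) ρ(|x|²/R) + F_R(|y|) + (|y|²/R) ρ(|y|²/R) ) · |x − y|. -/
open MeasureTheory Filter
open scoped BigOperators

noncomputable section

/-- Euclidean space `ℝ^d`. -/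
abbrev Ed (d : ℕ) := EuclideanSpace ℝ (Fin d)

theorem hasDerivAt_sub_integral_sub_mul {ρ : ℝ → ℝ} (hρ : Continuous ρ) (x : ℝ) :
    HasDerivAt (fun x : ℝ => x - ∫ y in (0 : ℝ)..x, (x - y) * ρ y)
      (1 - ∫ y in (0 : ℝ)..x, ρ y) x := by
  have hid : Continuous fun y : ℝ => y * ρ y := continuous_id.mul hρ
  have hsplit : (fun x : ℝ => x - ∫ y in (0 : ℝ)..x, (x - y) * ρ y)
      = fun x => x - (x * (∫ y in (0 : ℝ)..x, ρ y) - ∫ y in (0 : ℝ)..x, y * ρ y) := by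
    funext x
    rw [← intervalIntegral.integral_const_mul,
      ← intervalIntegral.integral_sub
        ((hρ.intervalIntegrable 0 x).const_mul x) (hid.intervalIntegrable 0 x)]
    simp only [sub_mul]
  rw [hsplit]
  have h₁ := hρ.integral_hasStrictDerivAt 0 x |>.hasDerivAt
  have h₂ := hid.integral_hasStrictDerivAt 0 x |>.hasDerivAt
  refine ((hasDerivAt_id' x).sub (((hasDerivAt_id' x).mul h₁).sub h₂)).congr_deriv ?_
  ring

theorem integral_sub_integral_le_mul {ρ : ℝ → ℝ} (hρ : Continuous ρ) {K u v : ℝ} (huv : u ≤ v)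
    (hK : ∀ t ∈ Set.Icc u v, ρ t ≤ K) :
    (∫ t in (0 : ℝ)..v, ρ t) - ∫ t in (0 : ℝ)..u, ρ t ≤ K * (v - u) := by
  rw [intervalIntegral.integral_interval_sub_left (hρ.intervalIntegrable _ _)
    (hρ.intervalIntegrable _ _)]
  calc ∫ t in u..v, ρ t ≤ ∫ _ in u..v, K :=
        intervalIntegral.integral_mono_on huv (hρ.intervalIntegrable _ _)
          intervalIntegrable_const hK
    _ = K * (v - u) := by simp [mul_comm]

/-- Control of the increments of `r ↦ ∫₀^{r²/R} ρ` for a bump `ρ` that is nondecreasing before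
`3/2` and vanishes outside `(1,3)`. -/
theorem exists_integral_sub_mul_le {ρ : ℝ → ℝ} (hρ : ContDiff ℝ 2 ρ)
    (hcpt : HasCompactSupport ρ) (hnonneg : ∀ x, 0 ≤ ρ x)
    (hsupp : Function.support ρ ⊆ Set.Ioo 1 3)
    (hpos : ∀ x ∈ Set.Ioo (5/4 : ℝ) (11/4 : ℝ), 0 < ρ x)
    (hmono : ∀ x ∈ Set.Ioo (1 : ℝ) (3/2 : ℝ), 0 ≤ deriv ρ x) {R : ℝ} (hR : 0 < R) :
    ∃ C > (0 : ℝ), ∀ r s : ℝ, 0 ≤ s → s ≤ r → r - s ≤ √R →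
      ((∫ t in (0 : ℝ)..(r^2/R), ρ t) - ∫ t in (0 : ℝ)..(s^2/R), ρ t) * r
        ≤ C * ((∫ t in (0 : ℝ)..(r^2/R), ρ t) + r^2/R * ρ (r^2/R)) * (r - s) := by
  have hc := hρ.continuous
  have hzero : ∀ t, t ∉ Set.Ioo (1 : ℝ) 3 → ρ t = 0 := fun t ht =>
    Function.notMem_support.1 fun h => ht (hsupp h)
  obtain ⟨M, hM⟩ := hcpt.exists_bound_of_continuous hc
  have hM' : ∀ t, ρ t ≤ M := fun t => (le_abs_self _).trans (hM t)
  have hM0 : 0 ≤ M := (hnonneg 0).trans (hM' 0)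
  have hii : ∀ a b : ℝ, IntervalIntegrable ρ volume a b := fun a b => hc.intervalIntegrable a b
  have hmass : 0 < ∫ t in (0 : ℝ)..(3/2), ρ t := by
    rw [← intervalIntegral.integral_add_adjacent_intervals (hii 0 (5/4)) (hii (5/4) (3/2))]
    refine add_pos_of_nonneg_of_pos
      (intervalIntegral.integral_nonneg (by norm_num) fun t _ => hnonneg t) ?_
    exact intervalIntegral.intervalIntegral_pos_of_pos_on (hii _ _)
      (fun t ht => hpos t ⟨ht.1, ht.2.trans (by norm_num)⟩) (by norm_num)
  set c := ∫ t in (0 : ℝ)..(3/2), ρ t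
  have hmonoOn : MonotoneOn ρ (Set.Icc 1 (3/2)) :=
    monotoneOn_of_deriv_nonneg (convex_Icc _ _) hc.continuousOn
      (hρ.differentiable (by norm_num)).differentiableOn
      (by rw [interior_Icc]; exact hmono)
  refine ⟨2 + 16 * M / c, by positivity, fun r s hs hsr hrs => ?_⟩
  have hr : 0 ≤ r := hs.trans hsr
  have hd : 0 ≤ r - s := sub_nonneg.2 hsr
  have hXY : s^2/R ≤ r^2/R := by gcongr
  have hX0 : 0 ≤ r^2/R := by positivity
  have hP0 : 0 ≤ ∫ t in (0 : ℝ)..(r^2/R), ρ t :=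
    intervalIntegral.integral_nonneg hX0 fun t _ => hnonneg t
  have hρX := hnonneg (r^2/R)
  have key : ∀ K, 0 ≤ K → (∀ t ∈ Set.Icc (s^2/R) (r^2/R), ρ t ≤ K) →
      ((∫ t in (0 : ℝ)..(r^2/R), ρ t) - ∫ t in (0 : ℝ)..(s^2/R), ρ t) * r
        ≤ 2 * (r^2/R) * K * (r - s) := by
    intro K hK hKt
    calc _ ≤ K * (r^2/R - s^2/R) * r := by
          gcongr
          exact integral_sub_integral_le_mul hc hXY hKt
      _ = K / R * (r * (r + s)) * (r - s) := by ring
      _ ≤ K / R * (r * (r + r)) * (r - s) := by gcongr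
      _ = _ := by ring
  rcases le_or_gt (r^2/R) (3/2) with hX | hX
  · refine (key (ρ (r^2/R)) hρX fun t ht => ?_).trans ?_
    · rcases le_or_gt t 1 with h1 | h1
      · rw [hzero t fun h => h1.not_gt h.1]
        exact hρX
      · exact hmonoOn ⟨h1.le, ht.2.trans hX⟩ ⟨h1.le.trans ht.2, hX⟩ ht.2
    · refine mul_le_mul_of_nonneg_right ?_ hd
      rw [mul_assoc]
      gcongr
      · linarith [show 0 ≤ 16 * M / c by positivity]
      · linarith
  · rcases le_or_gt 3 (s^2/R) with hY | hY
    · refine (key 0 le_rfl fun t ht => (hzero t fun h => ?_).le).trans ?_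
      · linarith [h.2, ht.1]
      · rw [mul_zero, zero_mul]
        positivity
    · have hX8 : r^2/R ≤ 8 := by
        rw [div_lt_iff₀ hR] at hY
        rw [div_le_iff₀ hR]
        have hsq : (r - s)^2 ≤ R := by
          rw [← Real.sq_sqrt hR.le]
          gcongr
        nlinarith [sq_nonneg (r - 2 * s)]
      have hcP : c ≤ ∫ t in (0 : ℝ)..(r^2/R), ρ t :=
        intervalIntegral.integral_mono_interval le_rfl (by norm_num) hX.le
          (Eventually.of_forall hnonneg) (hii _ _)
      refine (key M hM0 fun t _ => hM' t).trans (mul_le_mul_of_nonneg_right ?_ hd)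
      calc 2 * (r^2/R) * M ≤ 2 * 8 * M := by gcongr
        _ = 16 * M / c * c := by field_simp; ring
        _ ≤ (2 + 16 * M / c) * ((∫ t in (0 : ℝ)..(r^2/R), ρ t) + r^2/R * ρ (r^2/R)) := by
          gcongr
          · linarith
          · linarith [mul_nonneg hX0 hρX]

/-- Lemma 2.5 of the paper, the truncation lemma.  With
`ψ(x) = x − ∫₀ˣ (x−y)ρ(y)dy` and `F_R(r) = ∫₀^{r²/R} ρ(s)ds`, for each `R ≥ 1` there is
`C > 0` such that for all `x, y` with `max{|x|,|y|} ≥ √R` and `|x−y| ≤ √R`,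
`|(x−y) − (ψ'(|x|²/R)x − ψ'(|y|²/R)y)|
  ≤ C (F_R(|x|) + (|x|²/R)ρ(|x|²/R) + F_R(|y|) + (|y|²/R)ρ(|y|²/R)) |x−y|`. -/
theorem truncation_lemma
    (d : ℕ) (hd : 1 ≤ d)
    (ρ : ℝ → ℝ) (hρ_C2 : ContDiff ℝ 2 ρ) (hρ_cpt : HasCompactSupport ρ)
    (hρ_nonneg : ∀ x : ℝ, 0 ≤ ρ x)
    (hρ_supp : Function.support ρ ⊆ Set.Ioo 1 3)
    (hρ_pos : ∀ x ∈ Set.Ioo (5/4 : ℝ) (11/4 : ℝ), 0 < ρ x)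
    (hρ_int : (∫ x : ℝ, ρ x) = 1)
    (hρ_mono : ∀ x ∈ Set.Ioo (1 : ℝ) (3/2 : ℝ), 0 ≤ deriv ρ x)
    (hρ_sym : ∀ x : ℝ, ρ x = ρ (4 - x))
    (ψ : ℝ → ℝ) (hψ : ∀ x : ℝ, ψ x = x - ∫ y in (0:ℝ)..x, (x - y) * ρ y)
    (R : ℝ) (hR : 1 ≤ R)
    (F : ℝ → ℝ) (hF : ∀ r : ℝ, F r = ∫ s in (0:ℝ)..(r^2/R), ρ s) :
    ∃ C > (0:ℝ), ∀ x y : Ed d,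
      Real.sqrt R ≤ max ‖x‖ ‖y‖ → ‖x - y‖ ≤ Real.sqrt R →
      ‖(x - y) - (deriv ψ (‖x‖^2/R) • x - deriv ψ (‖y‖^2/R) • y)‖
        ≤ C * (F ‖x‖ + ‖x‖^2/R * ρ (‖x‖^2/R) + F ‖y‖ + ‖y‖^2/R * ρ (‖y‖^2/R)) * ‖x - y‖ := by
  have hR0 : 0 < R := one_pos.trans_le hR
  have hderiv : ∀ t, deriv ψ t = 1 - ∫ s in (0:ℝ)..t, ρ s := fun t => by
    rw [funext hψ]
    exact (hasDerivAt_sub_integral_sub_mul hρ_C2.continuous t).deriv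
  obtain ⟨C, hC, hbound⟩ := exists_integral_sub_mul_le hρ_C2 hρ_cpt hρ_nonneg hρ_supp hρ_pos
    hρ_mono hR0
  simp only [← hF] at hbound
  have hF0 : ∀ r, 0 ≤ F r := fun r => by
    rw [hF]
    exact intervalIntegral.integral_nonneg (by positivity) fun t _ => hρ_nonneg t
  have hFmono : ∀ r s, 0 ≤ s → s ≤ r → F s ≤ F r := fun r s hs hsr => by
    rw [hF, hF]
    exact intervalIntegral.integral_mono_interval le_rfl (by positivity) (by gcongr)
      (Eventually.of_forall hρ_nonneg) (hρ_C2.continuous.intervalIntegrable _ _)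
  have hG0 : ∀ r : ℝ, 0 ≤ r^2/R * ρ (r^2/R) := fun r => mul_nonneg (by positivity) (hρ_nonneg _)
  have ordered : ∀ x y : Ed d, ‖y‖ ≤ ‖x‖ → ‖x - y‖ ≤ √R →
      ‖F ‖x‖ • x - F ‖y‖ • y‖
        ≤ (1 + C) * (F ‖x‖ + ‖x‖^2/R * ρ (‖x‖^2/R) + F ‖y‖ + ‖y‖^2/R * ρ (‖y‖^2/R))
          * ‖x - y‖ := by
    intro x y hyx hxy
    have hsub := norm_sub_norm_le x y
    have hrw : F ‖x‖ • x - F ‖y‖ • y = F ‖y‖ • (x - y) + (F ‖x‖ - F ‖y‖) • x := by module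
    have hFx := hF0 ‖x‖
    have hFy := hF0 ‖y‖
    have hGx := hG0 ‖x‖
    have hGy := hG0 ‖y‖
    have hxbound : (F ‖x‖ - F ‖y‖) * ‖x‖
        ≤ C * (F ‖x‖ + ‖x‖^2/R * ρ (‖x‖^2/R)) * ‖x - y‖ :=
      (hbound _ _ (norm_nonneg y) hyx (hsub.trans hxy)).trans (by gcongr)
    calc ‖F ‖x‖ • x - F ‖y‖ • y‖ ≤ F ‖y‖ * ‖x - y‖ + (F ‖x‖ - F ‖y‖) * ‖x‖ := by
          rw [hrw]
          refine (norm_add_le _ _).trans_eq ?_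
          rw [norm_smul, norm_smul, Real.norm_of_nonneg hFy,
            Real.norm_of_nonneg (sub_nonneg.2 (hFmono _ _ (norm_nonneg y) hyx))]
      _ ≤ (F ‖y‖ + C * (F ‖x‖ + ‖x‖^2/R * ρ (‖x‖^2/R))) * ‖x - y‖ := by linarith
      _ ≤ _ := by
          gcongr
          linarith [mul_nonneg hC.le hFy, mul_nonneg hC.le hGy]
  refine ⟨1 + C, by positivity, fun x y _ hxy => ?_⟩
  have hexpr : (x - y) - (deriv ψ (‖x‖^2/R) • x - deriv ψ (‖y‖^2/R) • y)
      = F ‖x‖ • x - F ‖y‖ • y := by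
    rw [hderiv, hderiv, ← hF, ← hF]
    module
  rw [hexpr]
  rcases le_total ‖y‖ ‖x‖ with h | h
  · exact ordered x y h hxy
  · have hyx := ordered y x h (norm_sub_rev x y ▸ hxy)
    rw [norm_sub_rev, norm_sub_rev y x] at hyx
    refine hyx.trans_eq ?_
    ring
end
end

section
/- Let d ≥ 1, μ ∈ {−1,1}, and let V : ℝ^d → ℝ be bounded and measurable. Let I ⊆ ℝ be an interval, let γ^{(1)} : I × ℝ^d × ℝ^d → ℂ be C¹ in t and C² in the space variables with all these derivatives continuous, and let γ^{(2)} : I × ℝ^{2d} × ℝ^{2d} → ℂ be continuous with ∫ |γ^{(2)}(t,x,y,x',y)| dy < ∞. Assume the first Hartree hierarchy equation holds pointwise: i ∂_t γ^{(1)}(t,x,x') + (Δ_x − Δ_{x'}) γ^{(1)}(t,x,x') = μ ∫_{ℝ^d} γ^{(2)}(t,x,y,x',y)(V(x−y) − V(x'−y)) dy. Define P : I × ℝ^d → ℂ^d by P_j(t,x) = −i[(∂_{x_j} − ∂_{x'_j}) γ^{(1)}](t,x,x) for 1 ≤ j ≤ d (derivatives taken before restriction to the diagonal x' = x). Then for all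 (t,x) ∈ I × ℝ^d, ∂_t[γ^{(1)}(t,x,x)] + div_x P(t,x) = 0. -/
open MeasureTheory Filter
open scoped BigOperators ComplexConjugate RealInnerProductSpace

noncomputable section

/-- The `j`-th standard basis vector of `ℝ^d`. -/
def ebasis (d : ℕ) (j : Fin d) : Ed d := EuclideanSpace.single j (1 : ℝ)

/-- Laplacian of a complex-valued function on `ℝ^d`. -/
def lapC {d : ℕ} (f : Ed d → ℂ) (x : Ed d) : ℂ :=
  ∑ j : Fin d, fderiv ℝ (fun y => fderiv ℝ f y (ebasis d j)) x (ebasis d j)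

/-- Laplacian of a real-valued function on `ℝ^d`. -/
def lapR {d : ℕ} (f : Ed d → ℝ) (x : Ed d) : ℝ :=
  ∑ j : Fin d, fderiv ℝ (fun y => fderiv ℝ f y (ebasis d j)) x (ebasis d j)

section PartialDerivatives

variable {E F : Type*} [NormedAddCommGroup E] [NormedSpace ℝ E]
  [NormedAddCommGroup F] [NormedSpace ℝ F]

theorem fderiv_slice_left {f : E × E → F} (hf : Differentiable ℝ f) (a b v : E) :
    fderiv ℝ (fun z => f (z, b)) a v = fderiv ℝ f (a, b) (v, 0) := by
  have h := (hf (a, b)).hasFDerivAt.comp a (hasFDerivAt_prodMk_left (𝕜 := ℝ) a b)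
  simpa [Function.comp_def] using congrArg (fun L : E →L[ℝ] F => L v) h.fderiv

theorem fderiv_slice_right {f : E × E → F} (hf : Differentiable ℝ f) (a b v : E) :
    fderiv ℝ (fun z => f (a, z)) b v = fderiv ℝ f (a, b) (0, v) := by
  have h := (hf (a, b)).hasFDerivAt.comp b (hasFDerivAt_prodMk_right (𝕜 := ℝ) a b)
  simpa [Function.comp_def] using congrArg (fun L : E →L[ℝ] F => L v) h.fderiv

theorem fderiv_diagonal {f : E × E → F} (hf : Differentiable ℝ f) (a v : E) :
    fderiv ℝ (fun z => f (z, z)) a v = fderiv ℝ f (a, a) (v, v) := by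
  have h := HasFDerivAt.comp (f := fun z : E => (z, z)) a (hf (a, a)).hasFDerivAt
    ((hasFDerivAt_id a).prodMk (hasFDerivAt_id a))
  simpa [Function.comp_def] using congrArg (fun L : E →L[ℝ] F => L v) h.fderiv

/-- On the diagonal, `(∂₁ + ∂₂)(∂₁ - ∂₂) f = ∂₁² f - ∂₂² f`, the mixed derivatives cancelling
by symmetry. -/
theorem fderiv_diagonal_sub_partials {f : E × E → F} (hf : ContDiff ℝ 2 f) (x v : E) :
    fderiv ℝ (fun w => fderiv ℝ (fun z => f (z, w)) w v - fderiv ℝ (fun z => f (w, z)) w v) x v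
      = fderiv ℝ (fun y => fderiv ℝ (fun z => f (z, x)) y v) x v
        - fderiv ℝ (fun y => fderiv ℝ (fun z => f (x, z)) y v) x v := by
  have hf1 : Differentiable ℝ f := hf.differentiable (by norm_num)
  have hD : Differentiable ℝ (fderiv ℝ f) :=
    (hf.fderiv_right (m := 1) (by norm_num)).differentiable (by norm_num)
  have happ (u : E × E) : Differentiable ℝ (fun p => fderiv ℝ f p u) :=
    fun p => (hD p).clm_apply (differentiableAt_const u)
  have hsnd (p u w : E × E) :
      fderiv ℝ (fun q => fderiv ℝ f q u) p w = fderiv ℝ (fderiv ℝ f) p w u := by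
    simp [fderiv_clm_apply (hD p) (differentiableAt_const u)]
  have hsymm : IsSymmSndFDerivAt ℝ f (x, x) :=
    hf.contDiffAt.isSymmSndFDerivAt (by simp)
  simp only [fderiv_slice_left hf1, fderiv_slice_right hf1]
  rw [fderiv_slice_left (happ (v, 0)), fderiv_slice_right (happ (0, v)),
    fderiv_diagonal (f := fun p => fderiv ℝ f p (v, 0) - fderiv ℝ f p (0, v))
      ((happ (v, 0)).sub (happ (0, v))),
    fderiv_fun_sub (happ (v, 0) _) (happ (0, v) _)]
  have hsplit : ((v, v) : E × E) = (v, 0) + (0, v) := by simp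
  simp only [sub_apply, hsnd]
  rw [hsplit]
  simp only [map_add, add_apply]
  rw [hsymm (0, v) (v, 0)]
  abel

theorem differentiable_diagonal_sub_partials {f : E × E → F} (hf : ContDiff ℝ 2 f) (v : E) :
    Differentiable ℝ
      (fun w => fderiv ℝ (fun z => f (z, w)) w v - fderiv ℝ (fun z => f (w, z)) w v) := by
  have hf1 : Differentiable ℝ f := hf.differentiable (by norm_num)
  have hD : Differentiable ℝ (fderiv ℝ f) :=
    (hf.fderiv_right (m := 1) (by norm_num)).differentiable (by norm_num)
  simp only [fderiv_slice_left hf1, fderiv_slice_right hf1]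
  fun_prop

end PartialDerivatives

/-- Lemma 3.1 of the paper: the continuity equation.  If `(γ⁽¹⁾, γ⁽²⁾)`
satisfies the first Hartree hierarchy equation pointwise on `I`, then with
`Pⱼ(t,x) = −i[(∂_{xⱼ} − ∂_{x'ⱼ})γ⁽¹⁾](t,x,x)` one has
`∂ₜ[γ⁽¹⁾(t,x,x)] + div_x P(t,x) = 0`. -/
theorem continuity_equation
    (d : ℕ) (hd : 1 ≤ d) (μ : ℝ) (hμ : μ = -1 ∨ μ = 1)
    (V : Ed d → ℝ) (hV_meas : Measurable V) (hV_bdd : ∃ M : ℝ, ∀ x, |V x| ≤ M)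
    (I : Set ℝ) (hI : I.OrdConnected)
    (γ1 : ℝ → Ed d → Ed d → ℂ) (γ2 : ℝ → Ed d → Ed d → Ed d → Ed d → ℂ)
    (hγ1t : ∀ x x' : Ed d, ContDiffOn ℝ 1 (fun t => γ1 t x x') I)
    (hγ1x : ∀ t ∈ I, ContDiff ℝ 2 (fun p : Ed d × Ed d => γ1 t p.1 p.2))
    (hγ1cont : ContinuousOn
      (fun p : ℝ × (Ed d × Ed d) => γ1 p.1 p.2.1 p.2.2) (I ×ˢ (Set.univ : Set (Ed d × Ed d))))
    (hγ2cont : ContinuousOn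
      (fun p : ℝ × ((Ed d × Ed d) × (Ed d × Ed d)) => γ2 p.1 p.2.1.1 p.2.1.2 p.2.2.1 p.2.2.2)
      (I ×ˢ (Set.univ : Set ((Ed d × Ed d) × (Ed d × Ed d)))))
    (hγ2int : ∀ t ∈ I, ∀ x x' : Ed d, Integrable (fun y : Ed d => γ2 t x y x' y))
    (heq : ∀ t ∈ I, ∀ x x' : Ed d,
      Complex.I * deriv (fun s => γ1 s x x') t
        + (lapC (fun z => γ1 t z x') x - lapC (fun z => γ1 t x z) x')
      = (μ : ℂ) * ∫ y : Ed d, γ2 t x y x' y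
          * (((V (x - y) : ℝ) : ℂ) - ((V (x' - y) : ℝ) : ℂ))) :
    ∀ t ∈ I, ∀ x : Ed d,
      deriv (fun s => γ1 s x x) t
        + ∑ j : Fin d, fderiv ℝ (fun w : Ed d =>
            -Complex.I * (fderiv ℝ (fun z => γ1 t z w) w (ebasis d j)
              - fderiv ℝ (fun z => γ1 t w z) w (ebasis d j))) x (ebasis d j)
      = 0 := by
  intro t ht x
  have hG := hγ1x t ht
  have hdiag := heq t ht x x
  simp only [sub_self, mul_zero, integral_zero] at hdiag
  have hterm (j : Fin d) :
      fderiv ℝ (fun w : Ed d =>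
        -Complex.I * (fderiv ℝ (fun z => γ1 t z w) w (ebasis d j)
          - fderiv ℝ (fun z => γ1 t w z) w (ebasis d j))) x (ebasis d j)
      = -Complex.I * (fderiv ℝ (fun y => fderiv ℝ (fun z => γ1 t z x) y (ebasis d j)) x
            (ebasis d j)
          - fderiv ℝ (fun y => fderiv ℝ (fun z => γ1 t x z) y (ebasis d j)) x
            (ebasis d j)) := by
    rw [fderiv_const_mul (differentiable_diagonal_sub_partials hG (ebasis d j) x),
      smul_apply, smul_eq_mul]
    exact congrArg _ (fderiv_diagonal_sub_partials hG x (ebasis d j))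
  simp only [hterm]
  rw [← Finset.mul_sum, Finset.sum_sub_distrib]
  simp only [lapC] at hdiag
  linear_combination (-Complex.I) * hdiag + deriv (fun s => γ1 s x x) t * Complex.I_sq
end
end

section
/- Let d ≥ 1 and let ψ : [0,∞) → ℝ be smooth with ψ'' supported in (1,3) and ψ'', ψ''', ψ'''' bounded. For R > 0 define ψ_R(x) = R ψ(|x|²/R) on ℝ^d. Then there exists a constant C > 0, depending only on d and ψ, such that for all R ≥ 1: (i) (Δ²ψ_R)(x) = 0 whenever |x|² ≥ 3R or |x|² ≤ R, and (ii) |(Δ²ψ_R)(x)| ≤ C/R for all x ∈ ℝ^d. -/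
open MeasureTheory Filter
open scoped BigOperators ComplexConjugate RealInnerProductSpace

noncomputable section

/-- The Laplacian of a radial function written as a function of `‖x‖ ^ 2`. -/
theorem lapR_comp_norm_sq {d : ℕ} {g g₁ g₂ : ℝ → ℝ}
    (h₁ : ∀ s, HasDerivAt g (g₁ s) s) (h₂ : ∀ s, HasDerivAt g₁ (g₂ s) s) :
    lapR (fun y : Ed d => g (‖y‖ ^ 2)) =
      fun x : Ed d => 4 * ‖x‖ ^ 2 * g₂ (‖x‖ ^ 2) + 2 * d * g₁ (‖x‖ ^ 2) := by
  have inner_ebasis (y : Ed d) (j : Fin d) : ⟪y, ebasis d j⟫ = y j := by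
    simp [ebasis, EuclideanSpace.inner_single_right]
  have fderiv_comp (k k₁ : ℝ → ℝ) (hk : ∀ s, HasDerivAt k (k₁ s) s) (x : Ed d) :
      HasFDerivAt (fun y : Ed d => k (‖y‖ ^ 2)) (k₁ (‖x‖ ^ 2) • (2 • innerSL ℝ x)) x :=
    (hk _).comp_hasFDerivAt x (hasStrictFDerivAt_norm_sq x).hasFDerivAt
  funext x
  have hterm (j : Fin d) :
      fderiv ℝ (fun y => fderiv ℝ (fun y : Ed d => g (‖y‖ ^ 2)) y (ebasis d j)) x (ebasis d j) =
        4 * g₂ (‖x‖ ^ 2) * x j ^ 2 + 2 * g₁ (‖x‖ ^ 2) := by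
    have hfirst : (fun y => fderiv ℝ (fun y : Ed d => g (‖y‖ ^ 2)) y (ebasis d j)) =
        fun y => g₁ (‖y‖ ^ 2) * (2 * ⟪ebasis d j, y⟫) := by
      funext y
      rw [(fderiv_comp g g₁ h₁ y).fderiv]
      simp [real_inner_comm]
    have hlin : HasFDerivAt (fun y : Ed d => 2 * ⟪ebasis d j, y⟫)
        ((2 : ℝ) • innerSL ℝ (ebasis d j)) x :=
      (innerSL ℝ (ebasis d j)).hasFDerivAt.const_mul 2
    rw [hfirst, ((fderiv_comp g₁ g₂ h₂ x).fun_mul hlin).fderiv]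
    have hself : ⟪ebasis d j, ebasis d j⟫ = 1 := by simp [ebasis]
    simp only [add_apply, smul_apply, innerSL_apply_apply,
      smul_eq_mul, nsmul_eq_mul, hself, inner_ebasis, real_inner_comm x (ebasis d j)]
    push_cast
    ring
  simp only [lapR, hterm, Finset.sum_add_distrib, ← Finset.mul_sum]
  rw [← EuclideanSpace.real_norm_sq_eq]
  simp
  ring

/-- If a function vanishes on a set of unique differentiability, so does its derivative. -/
theorem deriv_eq_zero_of_eqOn_zero {f : ℝ → ℝ} {S : Set ℝ} (hS : UniqueDiffOn ℝ S)
    (hf : Differentiable ℝ f) (h : ∀ t ∈ S, f t = 0) : ∀ t ∈ S, deriv f t = 0 := by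
  intro t ht
  rw [← (hf t).derivWithin (hS t ht), derivWithin_congr (f := fun _ => 0) h (h t ht)]
  simp

/-- The bilaplacian of `R * ψ (‖x‖ ^ 2 / R)` in terms of the derivatives of `ψ`. -/
theorem lapR_lapR_rescaled_norm_sq (d : ℕ) {ψ : ℝ → ℝ} (hψ : ContDiff ℝ (⊤ : ℕ∞) ψ)
    {R : ℝ} (hR : R ≠ 0) (x : Ed d) :
    lapR (lapR (fun y : Ed d => R * ψ (‖y‖ ^ 2 / R))) x =
      (16 * (‖x‖ ^ 2 / R) ^ 2 * iteratedDeriv 4 ψ (‖x‖ ^ 2 / R)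
        + (32 + 16 * d) * (‖x‖ ^ 2 / R) * iteratedDeriv 3 ψ (‖x‖ ^ 2 / R)
        + (8 * d + 4 * d ^ 2) * iteratedDeriv 2 ψ (‖x‖ ^ 2 / R)) / R := by
  have hD (k : ℕ) (s : ℝ) : HasDerivAt (fun s => iteratedDeriv k ψ (s / R))
      (iteratedDeriv (k + 1) ψ (s / R) / R) s := by
    have hk : HasDerivAt (iteratedDeriv k ψ) (iteratedDeriv (k + 1) ψ (s / R)) (s / R) := by
      rw [iteratedDeriv_succ]
      exact (hψ.differentiable_iteratedDeriv k (mod_cast WithTop.coe_lt_top k) _).hasDerivAt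
    refine (hk.comp s ((hasDerivAt_id s).div_const R)).congr_deriv ?_
    ring
  have h₀ (s : ℝ) : HasDerivAt (fun s => R * ψ (s / R)) (iteratedDeriv 1 ψ (s / R)) s := by
    have h := (hD 0 s).const_mul R
    rw [mul_div_cancel₀ _ hR] at h
    simpa using h
  have h₁ (s : ℝ) : HasDerivAt
      (fun s => 4 * s * (iteratedDeriv 2 ψ (s / R) / R) + 2 * d * iteratedDeriv 1 ψ (s / R))
      (4 * s * (iteratedDeriv 3 ψ (s / R) / R ^ 2)
        + (4 + 2 * d) * (iteratedDeriv 2 ψ (s / R) / R)) s := by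
    refine ((((hasDerivAt_id s).const_mul 4).mul ((hD 2 s).div_const R)).add
      ((hD 1 s).const_mul (2 * d : ℝ))).congr_deriv ?_
    simp only [id]
    ring
  have h₂ (s : ℝ) : HasDerivAt
      (fun s => 4 * s * (iteratedDeriv 3 ψ (s / R) / R ^ 2)
        + (4 + 2 * d) * (iteratedDeriv 2 ψ (s / R) / R))
      (4 * s * (iteratedDeriv 4 ψ (s / R) / R ^ 3)
        + (8 + 2 * d) * (iteratedDeriv 3 ψ (s / R) / R ^ 2)) s := by
    refine ((((hasDerivAt_id s).const_mul 4).mul ((hD 3 s).div_const (R ^ 2))).add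
      (((hD 2 s).div_const R).const_mul (4 + 2 * d : ℝ))).congr_deriv ?_
    simp only [id]
    ring
  rw [lapR_comp_norm_sq h₀ (hD 1), lapR_comp_norm_sq h₁ h₂]
  field_simp
  ring

/-- if `ψ` is smooth with `ψ''` supported in `(1,3)` and `ψ''`, `ψ'''`,
`ψ''''` bounded, then for `ψ_R(x) = Rψ(|x|²/R)` there is a constant `C > 0` depending only
on `d` and `ψ` such that for all `R ≥ 1`: `Δ²ψ_R` vanishes when `|x|² ≥ 3R` or `|x|² ≤ R`,
and `|Δ²ψ_R(x)| ≤ C/R` everywhere. -/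
theorem bilaplacian_cutoff_bounds
    (d : ℕ) (hd : 1 ≤ d)
    (ψ : ℝ → ℝ) (hψ : ContDiff ℝ (⊤ : ℕ∞) ψ)
    (hsupp : Function.support (iteratedDeriv 2 ψ) ⊆ Set.Ioo 1 3)
    (hbdd : ∃ M : ℝ, ∀ k ∈ ({2, 3, 4} : Set ℕ), ∀ t : ℝ, |iteratedDeriv k ψ t| ≤ M) :
    ∃ C > (0:ℝ), ∀ R : ℝ, 1 ≤ R →
      (∀ x : Ed d, (3 * R ≤ ‖x‖^2 ∨ ‖x‖^2 ≤ R) →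
        lapR (lapR (fun y : Ed d => R * ψ (‖y‖^2 / R))) x = 0) ∧
      (∀ x : Ed d, |lapR (lapR (fun y : Ed d => R * ψ (‖y‖^2 / R))) x| ≤ C / R) := by
  obtain ⟨M, hM⟩ := hbdd
  have hM₀ : 0 ≤ M := (abs_nonneg _).trans (hM 2 (by simp) 0)
  have hdiff (k : ℕ) : Differentiable ℝ (iteratedDeriv k ψ) :=
    hψ.differentiable_iteratedDeriv k (mod_cast WithTop.coe_lt_top k)
  have hS : UniqueDiffOn ℝ (Set.Iic (1 : ℝ) ∪ Set.Ici 3) := by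
    rintro t (ht | ht)
    · exact (uniqueDiffOn_Iic 1 t ht).mono Set.subset_union_left
    · exact (uniqueDiffOn_Ici 3 t ht).mono Set.subset_union_right
  have hz₂ : ∀ t ∈ Set.Iic (1 : ℝ) ∪ Set.Ici 3, iteratedDeriv 2 ψ t = 0 := by
    intro t ht
    by_contra h
    have ht' := hsupp h
    rcases ht with ht | ht
    · exact ht'.1.not_ge ht
    · exact ht'.2.not_ge ht
  have hz₃ : ∀ t ∈ Set.Iic (1 : ℝ) ∪ Set.Ici 3, iteratedDeriv 3 ψ t = 0 := by
    rw [iteratedDeriv_succ]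
    exact deriv_eq_zero_of_eqOn_zero hS (hdiff 2) hz₂
  have hz₄ : ∀ t ∈ Set.Iic (1 : ℝ) ∪ Set.Ici 3, iteratedDeriv 4 ψ t = 0 := by
    rw [iteratedDeriv_succ]
    exact deriv_eq_zero_of_eqOn_zero hS (hdiff 3) hz₃
  refine ⟨16 * 3 ^ 2 * M + (32 + 16 * d) * 3 * M + (8 * d + 4 * d ^ 2) * M + 1, by positivity,
    fun R hR => ?_⟩
  have hR₀ : 0 < R := by linarith
  have hzero (x : Ed d) (hx : ‖x‖ ^ 2 / R ∈ Set.Iic (1 : ℝ) ∪ Set.Ici 3) :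
      lapR (lapR (fun y : Ed d => R * ψ (‖y‖ ^ 2 / R))) x = 0 := by
    rw [lapR_lapR_rescaled_norm_sq d hψ hR₀.ne', hz₂ _ hx, hz₃ _ hx, hz₄ _ hx]
    simp
  refine ⟨fun x hx => hzero x ?_, fun x => ?_⟩
  · rcases hx with hx | hx
    · exact Or.inr ((le_div_iff₀ hR₀).2 hx)
    · exact Or.inl ((div_le_one hR₀).2 hx)
  · by_cases hx : ‖x‖ ^ 2 / R ∈ Set.Iic (1 : ℝ) ∪ Set.Ici 3
    · rw [hzero x hx, abs_zero]
      positivity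
    · rw [lapR_lapR_rescaled_norm_sq d hψ hR₀.ne', abs_div, abs_of_pos hR₀]
      have ht₀ : 0 ≤ ‖x‖ ^ 2 / R := by positivity
      have ht₃ : ‖x‖ ^ 2 / R ≤ 3 := (not_le.1 fun h => hx (Or.inr h)).le
      generalize ‖x‖ ^ 2 / R = t at ht₀ ht₃
      have hb₂ := hM 2 (by simp) t
      have hb₃ := hM 3 (by simp) t
      have hb₄ := hM 4 (by simp) t
      gcongr
      calc _ ≤ |16 * t ^ 2 * iteratedDeriv 4 ψ t| + |(32 + 16 * d) * t * iteratedDeriv 3 ψ t|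
            + |(8 * d + 4 * d ^ 2) * iteratedDeriv 2 ψ t| := abs_add_three _ _ _
        _ = 16 * t ^ 2 * |iteratedDeriv 4 ψ t| + (32 + 16 * d) * t * |iteratedDeriv 3 ψ t|
            + (8 * d + 4 * d ^ 2) * |iteratedDeriv 2 ψ t| := by
          rw [abs_mul, abs_mul _ (iteratedDeriv 3 ψ t), abs_mul _ (iteratedDeriv 2 ψ t),
            abs_of_nonneg (by positivity : 0 ≤ 16 * t ^ 2),
            abs_of_nonneg (by positivity : 0 ≤ (32 + 16 * d) * t),
            abs_of_nonneg (by positivity : (0 : ℝ) ≤ 8 * d + 4 * d ^ 2)]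
        _ ≤ 16 * 3 ^ 2 * M + (32 + 16 * d) * 3 * M + (8 * d + 4 * d ^ 2) * M := by gcongr
        _ ≤ _ := by linarith
end
end

section
/- Let d ≥ 1 and let A : ℝ^d × ℝ^d → ℂ be a Schwartz function, A = A(x,x'). Then ∫_{ℝ^d} ( Δ_x(Δ_x A) − Δ_x(Δ_{x'} A) )(x,x) dx = 0, where Δ_x and Δ_{x'} denote the Laplacian in the first and second ℝ^d-variable respectively, and all derivatives are taken before restricting to the diagonal x' = x. -/
open MeasureTheory Filter
open scoped BigOperators ComplexConjugate RealInnerProductSpace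

noncomputable section

/-- Laplacian of a two-variable kernel in its first variable (before diagonal
restriction). -/
def lap1 {d : ℕ} (f : Ed d × Ed d → ℂ) : Ed d × Ed d → ℂ :=
  fun p => lapC (fun z => f (z, p.2)) p.1

/-- Laplacian of a two-variable kernel in its second variable (before diagonal
restriction). -/
def lap2 {d : ℕ} (f : Ed d × Ed d → ℂ) : Ed d × Ed d → ℂ :=
  fun p => lapC (fun z => f (p.1, z)) p.2

open scoped LineDeriv SchwartzMap

section LineDerivatives

variable {E F : Type*} [NormedAddCommGroup E] [NormedSpace ℝ E]
  [NormedAddCommGroup F] [NormedSpace ℝ F]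

theorem SchwartzMap.lineDerivOp_comm (v w : E) (f : 𝓢(E, F)) :
    ∂_{v} (∂_{w} f) = ∂_{w} (∂_{v} f) := by
  ext x
  have h (u : E) : ⇑(∂_{u} f : 𝓢(E, F)) = fun y => fderiv ℝ f y u := by
    ext y
    exact SchwartzMap.lineDerivOp_apply_eq_fderiv u f y
  have hd : DifferentiableAt ℝ (fderiv ℝ f) x :=
    ((f.smooth 2).fderiv_right (m := 1) (by norm_num)).differentiable (by norm_num) x
  have hsymm : IsSymmSndFDerivAt ℝ f x :=
    (f.smooth 2).contDiffAt.isSymmSndFDerivAt (by simp)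
  rw [SchwartzMap.lineDerivOp_apply_eq_fderiv, SchwartzMap.lineDerivOp_apply_eq_fderiv, h, h]
  have key (u z : E) : fderiv ℝ (fun y => fderiv ℝ f y u) x z = fderiv ℝ (fderiv ℝ f) x z u := by
    rw [fderiv_clm_apply hd (differentiableAt_const u)]
    simp
  rw [key, key, hsymm.eq]

/-- The derivative of a Schwartz function in a direction tangent to a linear subspace has vanishing
integral over that subspace. -/
theorem SchwartzMap.integral_lineDerivOp_comp_clm_eq_zero
    {D : Type*} [NormedAddCommGroup D] [NormedSpace ℝ D] [FiniteDimensional ℝ D]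
    [MeasurableSpace D] [BorelSpace D] (μ : Measure D) [μ.IsAddHaarMeasure]
    (f : 𝓢(E, ℂ)) (L : D →L[ℝ] E) {K : NNReal} (hL : AntilipschitzWith K L) (v : D) :
    Integrable (fun x => (∂_{L v} f) (L x)) μ ∧ ∫ x, (∂_{L v} f) (L x) ∂μ = 0 := by
  let C (g : 𝓢(E, ℂ)) : 𝓢(D, ℂ) :=
    SchwartzMap.compCLMOfAntilipschitz ℝ L.hasTemperateGrowth hL g
  have hfd (x : D) : fderiv ℝ (C f) x v = (∂_{L v} f) (L x) := by
    have h := (f.differentiableAt (x := L x)).hasFDerivAt.comp x L.hasFDerivAt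
    rw [SchwartzMap.lineDerivOp_apply_eq_fderiv]
    exact congrArg (fun T : D →L[ℝ] ℂ => T v) h.fderiv
  have hint : Integrable (fun x => (∂_{L v} f) (L x)) μ := (C (∂_{L v} f)).integrable
  refine ⟨hint, ?_⟩
  have h := integral_mul_fderiv_eq_neg_fderiv_mul_of_integrable (μ := μ)
    (f := fun _ : D => (1 : ℂ)) (g := C f) (v := v) (by simp) (by simpa [hfd] using hint)
    (by simpa using (C f).integrable) (fun _ _ => differentiableAt_const _)
    (fun _ _ => (C f).differentiableAt)
  simpa [hfd] using h

end LineDerivatives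

theorem lap1_schwartz {d : ℕ} (f : 𝓢(Ed d × Ed d, ℂ)) :
    lap1 f =
      ⇑(∑ j, ∂_{((ebasis d j, 0) : Ed d × Ed d)} (∂_{((ebasis d j, 0) : Ed d × Ed d)} f) :
        𝓢(Ed d × Ed d, ℂ)) := by
  have h (g : 𝓢(Ed d × Ed d, ℂ)) (y z v : Ed d) :
      fderiv ℝ (fun y => g (y, z)) y v = (∂_{((v, 0) : Ed d × Ed d)} g) (y, z) := by
    rw [SchwartzMap.lineDerivOp_apply_eq_fderiv]
    exact congrArg (fun T : Ed d →L[ℝ] ℂ => T v)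
      ((g.differentiableAt (x := (y, z))).hasFDerivAt.comp y
        (hasFDerivAt_prodMk_left y z)).fderiv
  ext p
  simp [lap1, lapC, h]

theorem lap2_schwartz {d : ℕ} (f : 𝓢(Ed d × Ed d, ℂ)) :
    lap2 f =
      ⇑(∑ j, ∂_{((0, ebasis d j) : Ed d × Ed d)} (∂_{((0, ebasis d j) : Ed d × Ed d)} f) :
        𝓢(Ed d × Ed d, ℂ)) := by
  have h (g : 𝓢(Ed d × Ed d, ℂ)) (y z v : Ed d) :
      fderiv ℝ (fun z => g (y, z)) z v = (∂_{((0, v) : Ed d × Ed d)} g) (y, z) := by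
    rw [SchwartzMap.lineDerivOp_apply_eq_fderiv]
    exact congrArg (fun T : Ed d →L[ℝ] ℂ => T v)
      ((g.differentiableAt (x := (y, z))).hasFDerivAt.comp z
        (hasFDerivAt_prodMk_right y z)).fderiv
  ext p
  simp [lap2, lapC, h]

/-- for a Schwartz kernel `A(x,x')`,
`∫ (Δ_x(Δ_x A) − Δ_x(Δ_{x'} A))(x,x) dx = 0`, all derivatives being taken before
restriction to the diagonal. -/
theorem trace_double_laplacian_identity
    (d : ℕ) (hd : 1 ≤ d) (A : SchwartzMap (Ed d × Ed d) ℂ) :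
    (∫ x : Ed d,
      (lap1 (lap1 (fun p => A p)) (x, x) - lap1 (lap2 (fun p => A p)) (x, x))) = 0 := by
  let a (j : Fin d) : Ed d × Ed d := (ebasis d j, 0)
  let b (j : Fin d) : Ed d × Ed d := (0, ebasis d j)
  let L : Ed d →L[ℝ] Ed d × Ed d := (ContinuousLinearMap.id ℝ _).prod (ContinuousLinearMap.id ℝ _)
  have hL : AntilipschitzWith 1 L := fun x y => by simp [L, Prod.edist_eq]
  have hLe (j : Fin d) : L (ebasis d j) = a j + b j := by simp [L, a, b]
  let T : 𝓢(Ed d × Ed d, ℂ) := ∑ j, ∂_{a j} (∂_{a j} A)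
  have h11 : lap1 (lap1 (fun p => A p)) =
      ⇑(∑ j, ∂_{a j} (∂_{a j} T) : 𝓢(Ed d × Ed d, ℂ)) := by
    rw [lap1_schwartz A, lap1_schwartz]
  have h12 : lap1 (lap2 (fun p => A p)) =
      ⇑(∑ j, ∂_{b j} (∂_{b j} T) : 𝓢(Ed d × Ed d, ℂ)) := by
    rw [lap2_schwartz A, lap1_schwartz]
    congr 1
    simp only [T, LineDeriv.lineDerivOp_sum]
    rw [Finset.sum_comm]
    refine Finset.sum_congr rfl fun k _ => Finset.sum_congr rfl fun j _ => ?_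
    change ∂_{a j} (∂_{a j} (∂_{b k} (∂_{b k} A))) = ∂_{b k} (∂_{b k} (∂_{a j} (∂_{a j} A)))
    rw [SchwartzMap.lineDerivOp_comm (a j) (b k), SchwartzMap.lineDerivOp_comm (a j) (b k),
      SchwartzMap.lineDerivOp_comm (a j) (b k), SchwartzMap.lineDerivOp_comm (a j) (b k)]
  have hdiv : ∑ j, ∂_{a j} (∂_{a j} T) - ∑ j, ∂_{b j} (∂_{b j} T) =
      ∑ j, ∂_{L (ebasis d j)} (∂_{a j} T - ∂_{b j} T) := by
    rw [← Finset.sum_sub_distrib]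
    refine Finset.sum_congr rfl fun j _ => ?_
    rw [hLe, LineDeriv.lineDerivOp_left_add, sub_eq_add_neg (∂_{a j} T),
      LineDeriv.lineDerivOp_add, LineDeriv.lineDerivOp_add, LineDeriv.lineDerivOp_neg,
      LineDeriv.lineDerivOp_neg, SchwartzMap.lineDerivOp_comm (a j) (b j)]
    abel
  have hpt (x : Ed d) :
      lap1 (lap1 (fun p => A p)) (x, x) - lap1 (lap2 (fun p => A p)) (x, x) =
        ∑ j, (∂_{L (ebasis d j)} (∂_{a j} T - ∂_{b j} T)) (L x) := by
    rw [h11, h12, ← sub_apply, hdiv, sum_apply]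
    rfl
  have hzero (j : Fin d) := SchwartzMap.integral_lineDerivOp_comp_clm_eq_zero volume
    (∂_{a j} T - ∂_{b j} T) L hL (ebasis d j)
  simp_rw [hpt]
  rw [integral_finsetSum _ fun j _ => (hzero j).1]
  exact Finset.sum_eq_zero fun j _ => (hzero j).2
end
end
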